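/- There exists an acyclic temporal network N = ((V ∪ {s}, A), τ) on 5 vertices (including s) with 8 arcs such that λ_N(s,v) ≥ 2 for all v ∈ V, and yet N contains no packing of 2 spanning τ-respecting s-arborescences. Consequently, for n = 5, time-respecting (n−3)-root-connectivity of an acyclic temporal network does not imply the existence of 2 arc-disjoint spanning time-respecting s-arborescences. -/

import Mathlib

/-- A directed graph (possibly with parallel arcs): arc type `At`, vertex type `Vt`,
each arc has a tail and a head. -/
structure Dgraph (Vt At : Type) where
  tail : At → Vt
  head : At → Vt

namespace Dgraph

variable {Vt At : Type}

/-- `D.WalkFrom u p v` : the list of arcs `p` forms a directed walk from `u` to `v`. -/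
def WalkFrom (D : Dgraph Vt At) : Vt → List At → Vt → Prop
  | u, [], v => u = v
  | u, a :: p, v => D.tail a = u ∧ D.WalkFrom (D.head a) p v

/-- The vertices visited by a walk starting at `u` with arc list `p`. -/
def walkVerts (D : Dgraph Vt At) (u : Vt) (p : List At) : List Vt :=
  u :: p.map D.head

/-- A directed path from `u` to `v`: a walk visiting pairwise distinct vertices. -/
def IsPath (D : Dgraph Vt At) (u : Vt) (p : List At) (v : Vt) : Prop :=
  D.WalkFrom u p v ∧ (D.walkVerts u p).Nodup

/-- An arc list is τ-respecting if its τ-values are non-decreasing. -/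
def Respects (τ : At → ℕ) (p : List At) : Prop :=
  List.Chain' (· ≤ ·) (p.map τ)

/-- An arc list is monochromatic w.r.t. a colouring `c` if all its arcs get the same colour. -/
def Monochromatic (c : At → Bool) (p : List At) : Prop :=
  ∀ a ∈ p, ∀ b ∈ p, c a = c b

/-- There is no directed cycle using only arcs of `B`
(equivalently, no nonempty closed directed walk inside `B`). -/
def AcyclicOn (D : Dgraph Vt At) (B : Set At) : Prop :=
  ¬ ∃ (v : Vt) (p : List At), p ≠ [] ∧ (∀ a ∈ p, a ∈ B) ∧ D.WalkFrom v p v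

/-- The directed graph contains no directed cycle. -/
def Acyclic (D : Dgraph Vt At) : Prop :=
  D.AcyclicOn Set.univ

/-- `u` reaches `v` by a directed walk. -/
def Reaches (D : Dgraph Vt At) (u v : Vt) : Prop :=
  ∃ p : List At, D.WalkFrom u p v

/-- `u` and `v` are in the same strongly connected component. -/
def MutuallyReachable (D : Dgraph Vt At) (u v : Vt) : Prop :=
  D.Reaches u v ∧ D.Reaches v u

/-- A temporal network `(D, τ)` is consistent if any two arcs lying in the same strongly
connected component (i.e. whose endpoints are all mutually reachable) have the same τ-value. -/
def Consistent (D : Dgraph Vt At) (τ : At → ℕ) : Prop :=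
  ∀ a b : At,
    D.MutuallyReachable (D.tail a) (D.head a) →
    D.MutuallyReachable (D.tail b) (D.head b) →
    D.MutuallyReachable (D.tail a) (D.tail b) →
    τ a = τ b

section Fin

variable [DecidableEq Vt] [Fintype At]

/-- The vertex set of the subgraph with arc set `B`, together with the root `s`. -/
def vertsF (D : Dgraph Vt At) (s : Vt) (B : Finset At) : Finset Vt :=
  insert s (B.image D.tail ∪ B.image D.head)

/-- In-degree of `v` in the subgraph with arc set `B`. -/
def indegOn (D : Dgraph Vt At) (B : Finset At) (v : Vt) : ℕ :=
  (B.filter (fun a => D.head a = v)).card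

/-- In-degree of `v`. -/
def indeg (D : Dgraph Vt At) (v : Vt) : ℕ :=
  D.indegOn Finset.univ v

/-- Out-degree of `v`. -/
def outdeg (D : Dgraph Vt At) (v : Vt) : ℕ :=
  (Finset.univ.filter (fun a => D.tail a = v)).card

/-- `ρ^i_N(v)` : the set of arcs entering `v` with τ-value at most `i`. -/
def rhoLe (D : Dgraph Vt At) (τ : At → ℕ) (v : Vt) (i : ℕ) : Finset At :=
  Finset.univ.filter (fun a => D.head a = v ∧ τ a ≤ i)

/-- `δ^i_N(v)` : the set of arcs leaving `v` with τ-value at most `i`. -/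
def deltaLe (D : Dgraph Vt At) (τ : At → ℕ) (v : Vt) (i : ℕ) : Finset At :=
  Finset.univ.filter (fun a => D.tail a = v ∧ τ a ≤ i)

/-- The temporal network `(D, τ)` with root `s` is pre-flow:
`|ρ^i_N(v)| ≥ |δ^i_N(v)|` for every `i` and every non-root vertex `v`. -/
def Preflow (D : Dgraph Vt At) (τ : At → ℕ) (s : Vt) : Prop :=
  ∀ (i : ℕ) (v : Vt), v ≠ s → (D.deltaLe τ v i).card ≤ (D.rhoLe τ v i).card

/-- The arc set `B` induces an `s`-arborescence: the subgraph contains `s`,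
has no directed cycle, and every vertex of it other than `s` has in-degree exactly 1. -/
def IsArb (D : Dgraph Vt At) (s : Vt) (B : Finset At) : Prop :=
  D.AcyclicOn (↑B) ∧ ∀ v ∈ D.vertsF s B, v ≠ s → D.indegOn B v = 1

/-- The arc set `B` induces a τ-respecting `s`-arborescence: an `s`-arborescence in which,
for every vertex `v` of the arborescence, the (unique) path from `s` to `v` is τ-respecting. -/
def IsTArb (D : Dgraph Vt At) (τ : At → ℕ) (s : Vt) (B : Finset At) : Prop :=
  D.IsArb s B ∧
    ∀ v ∈ D.vertsF s B, ∀ p : List At, (∀ a ∈ p, a ∈ B) → D.IsPath s p v → Respects τ p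

/-- There exist `k` pairwise arc-disjoint τ-respecting directed paths from `s` to `v`. -/
def HasTPaths (D : Dgraph Vt At) (τ : At → ℕ) (s v : Vt) (k : ℕ) : Prop :=
  ∃ P : Fin k → List At,
    (∀ i, D.IsPath s (P i) v ∧ Respects τ (P i)) ∧
    ∀ i j, i ≠ j → ∀ a, a ∈ P i → a ∉ P j

/-- `λ_N(s,v)` : the maximum number of pairwise arc-disjoint τ-respecting `(s,v)`-paths. -/
noncomputable def lambdaT (D : Dgraph Vt At) (τ : At → ℕ) (s v : Vt) : ℕ :=
  sSup {k | D.HasTPaths τ s v k}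

/-- `λ_D(s,v)` : the maximum number of pairwise arc-disjoint `(s,v)`-paths. -/
noncomputable def lambda (D : Dgraph Vt At) (s v : Vt) : ℕ :=
  D.lambdaT (fun _ => 0) s v

end Fin

end Dgraph

namespace Dgraph

variable {Vt At : Type}

theorem WalkFrom.eq_or_lt [Preorder Vt] {D : Dgraph Vt At}
    (h : ∀ a, D.tail a < D.head a) {u v : Vt} {p : List At} (hp : D.WalkFrom u p v) :
    (p = [] ∧ u = v) ∨ u < v := by
  induction p generalizing u with
  | nil => exact Or.inl ⟨rfl, hp⟩
  | cons a p ih =>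
    obtain ⟨rfl, hp⟩ := hp
    rcases ih hp with ⟨-, rfl⟩ | hlt
    · exact Or.inr (h a)
    · exact Or.inr ((h a).trans hlt)

theorem acyclic_of_tail_lt_head [Preorder Vt] {D : Dgraph Vt At}
    (h : ∀ a, D.tail a < D.head a) : D.Acyclic := by
  rintro ⟨v, p, hne, -, hp⟩
  rcases hp.eq_or_lt h with ⟨h_nil, -⟩ | hlt
  · exact hne h_nil
  · exact lt_irrefl v hlt

theorem HasTPaths.le_card [Fintype At] {D : Dgraph Vt At} {τ : At → ℕ} {s v : Vt}
    (hv : v ≠ s) {k : ℕ} (h : D.HasTPaths τ s v k) : k ≤ Fintype.card At := by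
  obtain ⟨P, hP, hdisj⟩ := h
  have hne : ∀ i, ∃ a, a ∈ P i := fun i => by
    refine List.exists_mem_of_ne_nil _ fun h_nil => hv ?_
    have hw := (hP i).1.1
    rw [h_nil] at hw
    exact Eq.symm hw
  choose f hf using hne
  have hinj : Function.Injective f := fun i j hij => by
    by_contra hne
    exact hdisj i j hne (f i) (hf i) (hij ▸ hf j)
  simpa using Fintype.card_le_of_injective f hinj

theorem HasTPaths.le_lambdaT [Fintype At] {D : Dgraph Vt At} {τ : At → ℕ} {s v : Vt}
    (hv : v ≠ s) {k : ℕ} (h : D.HasTPaths τ s v k) : k ≤ D.lambdaT τ s v :=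
  le_csSup ⟨Fintype.card At, fun _ hk => hk.le_card hv⟩ h

theorem hasTPaths_two {D : Dgraph Vt At} {τ : At → ℕ} {s v : Vt} {p q : List At}
    (hp : D.IsPath s p v) (hq : D.IsPath s q v) (hτp : Respects τ p) (hτq : Respects τ q)
    (hpq : p.Disjoint q) : D.HasTPaths τ s v 2 := by
  refine ⟨![p, q], ?_, ?_⟩
  · simp [Fin.forall_fin_two, hp, hq, hτp, hτq]
  · simp only [Fin.forall_fin_two, Matrix.cons_val_zero, Matrix.cons_val_one]
    exact ⟨⟨fun h => absurd rfl h, fun _ _ h₁ h₂ => hpq h₁ h₂⟩,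
      ⟨fun _ _ h₁ h₂ => hpq h₂ h₁, fun h => absurd rfl h⟩⟩

section Spanning

variable [DecidableEq Vt] [Fintype Vt] {D : Dgraph Vt At} {τ : At → ℕ} {s : Vt}
  {B : Finset At}

theorem IsTArb.respects (h : D.IsTArb τ s B) (hspan : D.vertsF s B = Finset.univ) {v : Vt}
    {p : List At} (hB : ∀ a ∈ p, a ∈ B) (hp : D.IsPath s p v) : Respects τ p :=
  h.2 v (hspan ▸ Finset.mem_univ v) p hB hp

theorem IsTArb.exists_entering_iff (h : D.IsTArb τ s B) (hspan : D.vertsF s B = Finset.univ)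
    {v : Vt} (hv : v ≠ s) : ∃ c, ∀ a, a ∈ B ∧ D.head a = v ↔ a = c := by
  obtain ⟨c, hc⟩ := Finset.card_eq_one.mp (h.1.2 v (hspan ▸ Finset.mem_univ v) hv)
  exact ⟨c, fun a => by simpa using Finset.ext_iff.mp hc a⟩

theorem IsTArb.mem_iff_notMem (h : D.IsTArb τ s B) (hspan : D.vertsF s B = Finset.univ)
    {v : Vt} (hv : v ≠ s) {a b : At} (hab : a ≠ b) (hD : ∀ e, D.head e = v ↔ e = a ∨ e = b) :
    a ∈ B ↔ b ∉ B := by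
  obtain ⟨c, hc⟩ := h.exists_entering_iff hspan hv
  have ha := hc a
  have hb := hc b
  have hcc := (hc c).mpr rfl
  grind

end Spanning

/-- A network on the vertices `0, …, 4` rooted at `0`, every other vertex having in-degree `2`. -/
def fiveVertexNetwork : Dgraph (Fin 5) (Fin 8) where
  tail := ![0, 0, 0, 1, 0, 1, 2, 3]
  head := ![1, 1, 2, 2, 3, 3, 4, 4]

/-- The time labels on the arcs of `fiveVertexNetwork`. -/
def fiveVertexLabels : Fin 8 → ℕ := ![0, 2, 0, 1, 0, 1, 0, 0]

instance decidableWalkFrom [DecidableEq Vt] (D : Dgraph Vt At) :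
    ∀ (u : Vt) (p : List At) (v : Vt), Decidable (D.WalkFrom u p v)
  | u, [], v => inferInstanceAs (Decidable (u = v))
  | u, a :: p, v =>
    have := decidableWalkFrom D (D.head a) p v
    inferInstanceAs (Decidable (D.tail a = u ∧ D.WalkFrom (D.head a) p v))

instance [DecidableEq Vt] (D : Dgraph Vt At) (u : Vt) (p : List At) (v : Vt) :
    Decidable (D.IsPath u p v) :=
  inferInstanceAs (Decidable (_ ∧ _))

instance (τ : At → ℕ) (p : List At) : Decidable (Respects τ p) :=
  inferInstanceAs (Decidable (List.IsChain _ _))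

theorem two_le_lambdaT_fiveVertexNetwork (v : Fin 5) (hv : v ≠ 0) :
    2 ≤ fiveVertexNetwork.lambdaT fiveVertexLabels 0 v := by
  refine HasTPaths.le_lambdaT hv ?_
  fin_cases v
  · exact absurd rfl hv
  · exact hasTPaths_two (p := [0]) (q := [1]) (by decide) (by decide) (by decide) (by decide)
      (by simp)
  · exact hasTPaths_two (p := [2]) (q := [0, 3]) (by decide) (by decide) (by decide) (by decide)
      (by simp)
  · exact hasTPaths_two (p := [4]) (q := [0, 5]) (by decide) (by decide) (by decide) (by decide)
      (by simp)
  · exact hasTPaths_two (p := [2, 6]) (q := [4, 7]) (by decide) (by decide) (by decide)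
      (by decide) (by simp)

theorem IsTArb.fiveVertexNetwork_mem {B : Finset (Fin 8)}
    (h : fiveVertexNetwork.IsTArb fiveVertexLabels 0 B)
    (hspan : fiveVertexNetwork.vertsF 0 B = Finset.univ) :
    ((0 ∈ B ↔ 1 ∉ B) ∧ (2 ∈ B ↔ 3 ∉ B) ∧ (4 ∈ B ↔ 5 ∉ B) ∧ (6 ∈ B ↔ 7 ∉ B)) ∧
      (1 ∈ B → 3 ∉ B ∧ 5 ∉ B) ∧ (3 ∈ B → 6 ∉ B) ∧ (5 ∈ B → 7 ∉ B) := by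
  have h₁ : 0 ∈ B ↔ 1 ∉ B := h.mem_iff_notMem hspan (v := 1) (by decide) (by decide) (by decide)
  have h₂ : 2 ∈ B ↔ 3 ∉ B := h.mem_iff_notMem hspan (v := 2) (by decide) (by decide) (by decide)
  have h₃ : 4 ∈ B ↔ 5 ∉ B := h.mem_iff_notMem hspan (v := 3) (by decide) (by decide) (by decide)
  have h₄ : 6 ∈ B ↔ 7 ∉ B := h.mem_iff_notMem hspan (v := 4) (by decide) (by decide) (by decide)
  have late {v : Fin 5} (p : List (Fin 8)) (hp : fiveVertexNetwork.IsPath 0 p v)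
      (hτ : ¬ Respects fiveVertexLabels p) : ¬ ∀ a ∈ p, a ∈ B :=
    fun hB => hτ (h.respects hspan hB hp)
  have h₁₃ := late (v := 2) [1, 3] (by decide) (by decide)
  have h₁₅ := late (v := 3) [1, 5] (by decide) (by decide)
  have h₀₃₆ := late (v := 4) [0, 3, 6] (by decide) (by decide)
  have h₀₅₇ := late (v := 4) [0, 5, 7] (by decide) (by decide)
  simp only [List.forall_mem_cons, List.not_mem_nil, false_imp_iff, implies_true, and_true]
    at h₁₃ h₁₅ h₀₃₆ h₀₅₇
  grind

theorem fiveVertexNetwork_not_packing :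
    ¬ ∃ B₁ B₂ : Finset (Fin 8), Disjoint B₁ B₂ ∧
        fiveVertexNetwork.IsTArb fiveVertexLabels 0 B₁ ∧
        fiveVertexNetwork.vertsF 0 B₁ = Finset.univ ∧
        fiveVertexNetwork.IsTArb fiveVertexLabels 0 B₂ ∧
        fiveVertexNetwork.vertsF 0 B₂ = Finset.univ := by
  rintro ⟨B₁, B₂, hdisj, h₁, hs₁, h₂, hs₂⟩
  have m₁ := h₁.fiveVertexNetwork_mem hs₁
  have m₂ := h₂.fiveVertexNetwork_mem hs₂
  have hd (a : Fin 8) : a ∈ B₁ → a ∉ B₂ := fun ha => Finset.disjoint_left.mp hdisj ha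
  have d₀ := hd 0
  have d₁ := hd 1
  have d₂ := hd 2
  have d₃ := hd 3
  have d₄ := hd 4
  have d₅ := hd 5
  have d₆ := hd 6
  have d₇ := hd 7
  clear hd
  grind

end Dgraph

/-- There exists an acyclic temporal network on `5` vertices (including the
root `s`) with `8` arcs that is time-respecting `2`-root-connected and yet has no packing
of `2` spanning τ-respecting `s`-arborescences. Hence, for `n = 5`, time-respecting
`(n-3)`-root-connectivity of an acyclic temporal network does not imply the existence of
`2` arc-disjoint spanning time-respecting `s`-arborescences. -/
theorem exists_acyclic_five_vertices_counterexample :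
    ∃ (D : Dgraph (Fin 5) (Fin 8)) (τ : Fin 8 → ℕ) (s : Fin 5),
      (∀ a : Fin 8, D.head a ≠ s) ∧
      D.Acyclic ∧
      (∀ v : Fin 5, v ≠ s → 2 ≤ D.lambdaT τ s v) ∧
      ¬ ∃ B₁ B₂ : Finset (Fin 8), Disjoint B₁ B₂ ∧
          D.IsTArb τ s B₁ ∧ D.vertsF s B₁ = Finset.univ ∧
          D.IsTArb τ s B₂ ∧ D.vertsF s B₂ = Finset.univ := by
  exact ⟨Dgraph.fiveVertexNetwork, Dgraph.fiveVertexLabels, 0, by decide,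
    Dgraph.acyclic_of_tail_lt_head (by decide), Dgraph.two_le_lambdaT_fiveVertexNetwork,
    Dgraph.fiveVertexNetwork_not_packing⟩
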